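/- Let E be a reflexive geodesic space with convex metric and no bifurcating geodesics, and let A be a nonempty compact subset of E. Then the set W_min = { X ∈ P^A_{b,cl,cv}(E) : min(A,X) is well-posed } is a dense G_δ-set in the metric space (P^A_{b,cl,cv}(E), h). -/

import Mathlib

open Metric Set Filter Bornology

noncomputable section

/-- A geodesic path of length `l`: a map `c : ℝ → E` that is isometric on `[0, l]`. -/
def IsGeodesicPath {E : Type*} [MetricSpace E] (c : ℝ → E) (l : ℝ) : Prop :=
  0 ≤ l ∧ ∀ s ∈ Icc (0:ℝ) l, ∀ t ∈ Icc (0:ℝ) l, dist (c s) (c t) = |s - t|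

/-- `S` is a geodesic segment joining `x` and `y`. -/
def IsGeodesicSegment {E : Type*} [MetricSpace E] (S : Set E) (x y : E) : Prop :=
  ∃ c l, IsGeodesicPath c l ∧ c 0 = x ∧ c l = y ∧ S = c '' Icc (0:ℝ) l

/-- A geodesic (line): an isometric image of `ℝ`. -/
def IsGeodesicLine {E : Type*} [MetricSpace E] (S : Set E) : Prop :=
  ∃ c : ℝ → E, Isometry c ∧ S = Set.range c

/-- `E` is a geodesic space: every two points are joined by a geodesic path. -/
def IsGeodesicSpace (E : Type*) [MetricSpace E] : Prop :=
  ∀ x y : E, ∃ S, IsGeodesicSegment S x y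

/-- `E` has the geodesic extension property: every geodesic segment is contained
in a geodesic. -/
def GeodesicExtensionProperty (E : Type*) [MetricSpace E] : Prop :=
  ∀ (S : Set E) (x y : E), IsGeodesicSegment S x y → ∃ L, IsGeodesicLine L ∧ S ⊆ L

/-- The metric of `E` is convex. -/
def HasConvexMetric (E : Type*) [MetricSpace E] : Prop :=
  ∀ (c₁ c₂ : ℝ → E) (l₁ l₂ : ℝ), IsGeodesicPath c₁ l₁ → IsGeodesicPath c₂ l₂ →
    ∀ t ∈ Icc (0:ℝ) 1,
      dist (c₁ (t * l₁)) (c₂ (t * l₂)) ≤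
        (1 - t) * dist (c₁ 0) (c₂ 0) + t * dist (c₁ l₁) (c₂ l₂)

/-- A subset `X` is (geodesically) convex: any geodesic segment joining two points
of `X` is contained in `X`. -/
def GeodesicConvex {E : Type*} [MetricSpace E] (X : Set E) : Prop :=
  ∀ x ∈ X, ∀ y ∈ X, ∀ S : Set E, IsGeodesicSegment S x y → S ⊆ X

/-- A function `f : E → ℝ` is (geodesically) convex. -/
def GeodesicConvexFun {E : Type*} [MetricSpace E] (f : E → ℝ) : Prop :=
  ∀ (c : ℝ → E) (l : ℝ), IsGeodesicPath c l → ∀ t ∈ Icc (0:ℝ) 1,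
    f (c (t * l)) ≤ (1 - t) * f (c 0) + t * f (c l)

/-- `G₁(S)`: the union of all geodesic segments with endpoints in `S`. -/
def geodSegUnion {E : Type*} [MetricSpace E] (S : Set E) : Set E :=
  {z | ∃ x ∈ S, ∃ y ∈ S, ∃ T : Set E, IsGeodesicSegment T x y ∧ z ∈ T}

/-- The iterates `G_n(S)`. -/
def geodGn {E : Type*} [MetricSpace E] (S : Set E) : ℕ → Set E
  | 0 => S
  | n + 1 => geodSegUnion (geodGn S n)

/-- The (geodesic) convex hull `co(S) = ⋃ₙ G_n(S)`. -/
def geodConvexHull {E : Type*} [MetricSpace E] (S : Set E) : Set E :=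
  ⋃ n, geodGn S n

/-- `E` is without bifurcating geodesics. -/
def NoBifurcatingGeodesics (E : Type*) [MetricSpace E] : Prop :=
  ∀ (p a b : E) (S₁ S₂ : Set E), IsGeodesicSegment S₁ p a → IsGeodesicSegment S₂ p b →
    ∀ z, z ∈ S₁ → z ∈ S₂ → z ≠ p → (z = a ∧ z = b) ∨ S₁ ⊆ S₂ ∨ S₂ ⊆ S₁

/-- `E` is reflexive: every descending sequence of nonempty, bounded, closed and convex
subsets of `E` has nonempty intersection. -/
def ReflexiveGeodesicSpace (E : Type*) [MetricSpace E] : Prop :=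
  ∀ C : ℕ → Set E, (∀ n, (C n).Nonempty) → (∀ n, IsBounded (C n)) → (∀ n, IsClosed (C n)) →
    (∀ n, GeodesicConvex (C n)) → (∀ n, C (n + 1) ⊆ C n) → (⋂ n, C n).Nonempty

/-- `Dist(x, A)`: the remotal (farthest) distance from `x` to `A`. -/
def supDist {E : Type*} [MetricSpace E] (x : E) (A : Set E) : ℝ :=
  sSup ((fun a => dist x a) '' A)

/-- `λ_{XY} = inf{ d(x,y) : x ∈ X, y ∈ Y }`. -/
def infSetDist {E : Type*} [MetricSpace E] (X Y : Set E) : ℝ :=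
  sInf (Set.image2 dist X Y)

/-- `μ_{XY} = sup{ d(x,y) : x ∈ X, y ∈ Y }`. -/
def supSetDist {E : Type*} [MetricSpace E] (X Y : Set E) : ℝ :=
  sSup (Set.image2 dist X Y)

/-- `L_{XY}(σ) = { x ∈ X : dist(x,Y) ≤ λ_{XY} + σ }`. -/
def Lset {E : Type*} [MetricSpace E] (X Y : Set E) (σ : ℝ) : Set E :=
  {x ∈ X | infDist x Y ≤ infSetDist X Y + σ}

/-- `M_{XY}(σ) = { x ∈ X : Dist(x,Y) ≥ μ_{XY} − σ }`. -/
def Mset {E : Type*} [MetricSpace E] (X Y : Set E) (σ : ℝ) : Set E :=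
  {x ∈ X | supSetDist X Y - σ ≤ supDist x Y}

/-- The minimization problem `min(X,Y)` is well-posed. -/
def MinWellPosed {E : Type*} [MetricSpace E] (X Y : Set E) : Prop :=
  ∃ x₀ ∈ X, ∃ y₀ ∈ Y, dist x₀ y₀ = infSetDist X Y ∧
    (∀ x ∈ X, ∀ y ∈ Y, dist x y = infSetDist X Y → x = x₀ ∧ y = y₀) ∧
    ∀ x : ℕ → E, ∀ y : ℕ → E, (∀ n, x n ∈ X) → (∀ n, y n ∈ Y) →
      Tendsto (fun n => dist (x n) (y n)) atTop (nhds (infSetDist X Y)) →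
      Tendsto x atTop (nhds x₀) ∧ Tendsto y atTop (nhds y₀)

/-- The maximization problem `max(X,Y)` is well-posed. -/
def MaxWellPosed {E : Type*} [MetricSpace E] (X Y : Set E) : Prop :=
  ∃ x₀ ∈ X, ∃ y₀ ∈ Y, dist x₀ y₀ = supSetDist X Y ∧
    (∀ x ∈ X, ∀ y ∈ Y, dist x y = supSetDist X Y → x = x₀ ∧ y = y₀) ∧
    ∀ x : ℕ → E, ∀ y : ℕ → E, (∀ n, x n ∈ X) → (∀ n, y n ∈ Y) →
      Tendsto (fun n => dist (x n) (y n)) atTop (nhds (supSetDist X Y)) →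
      Tendsto x atTop (nhds x₀) ∧ Tendsto y atTop (nhds y₀)

/-- The distance of the model space `M²_κ` (κ < 0): the hyperbolic distance
multiplied by `1/√(-κ)`. -/
def kdist (κ : ℝ) (a b : UpperHalfPlane) : ℝ :=
  (Real.sqrt (-κ))⁻¹ * dist a b

/-- `pb` is the comparison point in `M²_κ` (relative to the side from `xi` to `xj`,
with comparison vertices `xib`, `xjb`) of a point `p` on a geodesic segment from
`xi` to `xj`. -/
def IsComparisonPoint {E : Type*} [MetricSpace E] (κ : ℝ) (xi xj : E)
    (xib xjb : UpperHalfPlane) (p : E) (pb : UpperHalfPlane) : Prop :=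
  kdist κ xib pb = dist xi p ∧ kdist κ pb xjb = dist p xj

/-- `E` has curvature bounded below by `κ < 0`: every geodesic triangle satisfies the
reversed CAT(κ) inequality with respect to any κ-comparison triangle in `M²_κ`. -/
def CurvBoundedBelow (E : Type*) [MetricSpace E] (κ : ℝ) : Prop :=
  ∀ (x₁ x₂ x₃ : E) (S₁₂ S₂₃ S₁₃ : Set E),
    IsGeodesicSegment S₁₂ x₁ x₂ → IsGeodesicSegment S₂₃ x₂ x₃ → IsGeodesicSegment S₁₃ x₁ x₃ →
    ∀ x₁b x₂b x₃b : UpperHalfPlane,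
      kdist κ x₁b x₂b = dist x₁ x₂ → kdist κ x₂b x₃b = dist x₂ x₃ →
      kdist κ x₁b x₃b = dist x₁ x₃ →
      ∀ (p q : E) (pb qb : UpperHalfPlane),
        ((p ∈ S₁₂ ∧ IsComparisonPoint κ x₁ x₂ x₁b x₂b p pb) ∨
         (p ∈ S₂₃ ∧ IsComparisonPoint κ x₂ x₃ x₂b x₃b p pb) ∨
         (p ∈ S₁₃ ∧ IsComparisonPoint κ x₁ x₃ x₁b x₃b p pb)) →
        ((q ∈ S₁₂ ∧ IsComparisonPoint κ x₁ x₂ x₁b x₂b q qb) ∨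
         (q ∈ S₂₃ ∧ IsComparisonPoint κ x₂ x₃ x₂b x₃b q qb) ∨
         (q ∈ S₁₃ ∧ IsComparisonPoint κ x₁ x₃ x₁b x₃b q qb)) →
        kdist κ pb qb ≤ dist p q

/-- Comparison points for Euclidean (κ = 0) comparison triangles in `ℝ²`. -/
def IsComparisonPointE {E : Type*} [MetricSpace E] (xi xj : E)
    (xib xjb : EuclideanSpace ℝ (Fin 2)) (p : E) (pb : EuclideanSpace ℝ (Fin 2)) : Prop :=
  dist xib pb = dist xi p ∧ dist pb xjb = dist p xj

/-- `E` is a CAT(0) space: a geodesic space where every geodesic triangle satisfies the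
CAT(0) comparison inequality with respect to Euclidean comparison triangles. -/
def CATZero (E : Type*) [MetricSpace E] : Prop :=
  IsGeodesicSpace E ∧
  ∀ (x₁ x₂ x₃ : E) (S₁₂ S₂₃ S₁₃ : Set E),
    IsGeodesicSegment S₁₂ x₁ x₂ → IsGeodesicSegment S₂₃ x₂ x₃ → IsGeodesicSegment S₁₃ x₁ x₃ →
    ∀ x₁b x₂b x₃b : EuclideanSpace ℝ (Fin 2),
      dist x₁b x₂b = dist x₁ x₂ → dist x₂b x₃b = dist x₂ x₃ → dist x₁b x₃b = dist x₁ x₃ →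
      ∀ (p q : E) (pb qb : EuclideanSpace ℝ (Fin 2)),
        ((p ∈ S₁₂ ∧ IsComparisonPointE x₁ x₂ x₁b x₂b p pb) ∨
         (p ∈ S₂₃ ∧ IsComparisonPointE x₂ x₃ x₂b x₃b p pb) ∨
         (p ∈ S₁₃ ∧ IsComparisonPointE x₁ x₃ x₁b x₃b p pb)) →
        ((q ∈ S₁₂ ∧ IsComparisonPointE x₁ x₂ x₁b x₂b q qb) ∨
         (q ∈ S₂₃ ∧ IsComparisonPointE x₂ x₃ x₂b x₃b q qb) ∨
         (q ∈ S₁₃ ∧ IsComparisonPointE x₁ x₃ x₁b x₃b q qb)) →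
        dist p q ≤ dist pb qb

/-- The space `P_{b,cl,cv}(E)` of nonempty, bounded, closed and convex subsets of `E`. -/
def Pbclcv (E : Type*) [MetricSpace E] : Type _ :=
  {X : Set E // X.Nonempty ∧ IsBounded X ∧ IsClosed X ∧ GeodesicConvex X}

/-- `P_{b,cl,cv}(E)` carries the Pompeiu-Hausdorff distance. -/
instance Pbclcv.metricSpace (E : Type*) [MetricSpace E] : MetricSpace (Pbclcv E) where
  dist X Y := hausdorffDist X.1 Y.1
  dist_self X := hausdorffDist_self_zero
  dist_comm X Y := hausdorffDist_comm
  dist_triangle X Y Z := hausdorffDist_triangle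
    (hausdorffEdist_ne_top_of_nonempty_of_bounded X.2.1 Y.2.1 X.2.2.1 Y.2.2.1)
  eq_of_dist_eq_zero := by
    intro X Y h
    exact Subtype.ext ((X.2.2.2.1.hausdorffDist_zero_iff_eq Y.2.2.2.1
      (hausdorffEdist_ne_top_of_nonempty_of_bounded X.2.1 Y.2.1 X.2.2.1 Y.2.2.1)).mp h)

/-- `P^A_{b,cl,cv}(E)`: the closure in `(P_{b,cl,cv}(E), h)` of the family of sets at
positive distance from `A`. -/
def PAbclcv {E : Type*} [MetricSpace E] (A : Set E) : Set (Pbclcv E) :=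
  closure {X : Pbclcv E | 0 < infSetDist X.1 A}

/-- The inverse hyperbolic cosine. -/
def arcosh (x : ℝ) : ℝ := Real.log (x + Real.sqrt (x ^ 2 - 1))

/-- The function `F_κ`. -/
def Fkappa (κ d r σ : ℝ) : ℝ :=
  2 / Real.sqrt (-κ) *
    arcosh (Real.cosh (Real.sqrt (-κ) * (r - d + σ)) ^ 2 -
      Real.sinh (Real.sqrt (-κ) * (r - d + σ)) / Real.sinh (Real.sqrt (-κ) * d) *
        (Real.cosh (Real.sqrt (-κ) * r) -
          Real.cosh (Real.sqrt (-κ) * d) * Real.cosh (Real.sqrt (-κ) * (r - d + σ))))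

/-- The petal `P_{α,δ}(x₀, f)`. -/
def petal {E : Type*} [MetricSpace E] (f : E → ℝ) (α δ : ℝ) (x₀ : E) : Set E :=
  {x | f x ≤ f x₀ - α * dist x x₀ + δ}

/-- `L_{A,f}(σ)`. -/
def LsetFun {E : Type*} [MetricSpace E] (A : Set E) (f : E → ℝ) (σ : ℝ) : Set E :=
  {x | f x ≤ sInf (f '' A) + σ ∧ infDist x A ≤ σ}

/-- The problem `min(A,f)` is well-posed in the sense of Revalski. -/
def RevalskiWellPosed {E : Type*} [MetricSpace E] (A : Set E) (f : E → ℝ) : Prop :=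
  sInf ((fun σ => diam (LsetFun A f σ)) '' Ioi 0) = 0

/-- The nearest point problem `min(X,y)` is well-posed. -/
def PointMinWellPosed {E : Type*} [MetricSpace E] (X : Set E) (y : E) : Prop :=
  ∃ x₀ ∈ X, dist x₀ y = infDist y X ∧ (∀ x ∈ X, dist x y = infDist y X → x = x₀) ∧
    ∀ x : ℕ → E, (∀ n, x n ∈ X) →
      Tendsto (fun n => dist (x n) y) atTop (nhds (infDist y X)) →
      Tendsto x atTop (nhds x₀)

end

section InfSetDist

variable {E : Type*} [MetricSpace E] {X Y A : Set E}

theorem infSetDist_le_dist {x y : E} (hx : x ∈ X) (hy : y ∈ Y) :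
    infSetDist X Y ≤ dist x y := by
  refine csInf_le ⟨0, ?_⟩ ⟨x, hx, y, hy, rfl⟩
  rintro _ ⟨a, _, b, _, rfl⟩
  exact dist_nonneg

theorem le_infSetDist {r : ℝ} (hX : X.Nonempty) (hY : Y.Nonempty)
    (h : ∀ x ∈ X, ∀ y ∈ Y, r ≤ dist x y) : r ≤ infSetDist X Y := by
  refine le_csInf (hX.image2 hY) ?_
  rintro _ ⟨a, ha, b, hb, rfl⟩
  exact h a ha b hb

theorem infSetDist_comm (X Y : Set E) : infSetDist X Y = infSetDist Y X := by
  unfold infSetDist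
  rw [Set.image2_swap]
  simp only [dist_comm]

theorem infSetDist_le_infSetDist_add_hausdorffDist (hA : A.Nonempty) (hX : X.Nonempty)
    (hXY : hausdorffEDist X Y ≠ ⊤) :
    infSetDist A Y ≤ infSetDist A X + hausdorffDist X Y := by
  rw [← sub_le_iff_le_add]
  refine le_infSetDist hA hX fun a ha x hx => ?_
  rw [sub_le_iff_le_add]
  refine le_of_forall_pos_lt_add fun δ hδ => ?_
  obtain ⟨y, hy, hxy⟩ := exists_dist_lt_of_hausdorffDist_lt hx
    (lt_add_of_pos_right (hausdorffDist X Y) hδ) hXY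
  linarith [infSetDist_le_dist ha hy, dist_triangle a x y]

end InfSetDist

section Convexity

variable {E : Type*} [MetricSpace E]

theorem IsGeodesicPath.dist_endpoints {c : ℝ → E} {l : ℝ} (hc : IsGeodesicPath c l) :
    dist (c 0) (c l) = l := by
  rw [hc.2 0 (left_mem_Icc.2 hc.1) l (right_mem_Icc.2 hc.1), zero_sub, abs_neg,
    abs_of_nonneg hc.1]

theorem IsGeodesicSpace.exists_path (hgeo : IsGeodesicSpace E) (x y : E) :
    ∃ c : ℝ → E, IsGeodesicPath c (dist x y) ∧ c 0 = x ∧ c (dist x y) = y := by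
  obtain ⟨_, c, l, hc, rfl, rfl, _⟩ := hgeo x y
  exact ⟨c, by rwa [hc.dist_endpoints], rfl, by rw [hc.dist_endpoints]⟩

theorem isGeodesicPath_const (z : E) : IsGeodesicPath (fun _ => z) 0 := by
  refine ⟨le_rfl, fun s hs t ht => ?_⟩
  rw [Icc_self, mem_singleton_iff] at hs ht
  simp [hs, ht]

theorem geodesicConvexFun_dist (hconv : HasConvexMetric E) (z : E) :
    GeodesicConvexFun fun x => dist x z := by
  intro c l hc t ht
  simpa using hconv c (fun _ => z) l 0 hc (isGeodesicPath_const z) t ht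

theorem geodesicConvexFun_infDist (hgeo : IsGeodesicSpace E) (hconv : HasConvexMetric E)
    {X : Set E} (hne : X.Nonempty) (hX : GeodesicConvex X) :
    GeodesicConvexFun fun x => infDist x X := by
  intro c l hc t ht
  refine le_of_forall_pos_le_add fun δ hδ => ?_
  obtain ⟨p, hp, hcp⟩ := (infDist_lt_iff hne).1 (lt_add_of_pos_right (infDist (c 0) X) hδ)
  obtain ⟨q, hq, hcq⟩ := (infDist_lt_iff hne).1 (lt_add_of_pos_right (infDist (c l) X) hδ)
  obtain ⟨c', hc', h0, h1⟩ := hgeo.exists_path p q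
  have hmem : c' (t * dist p q) ∈ X :=
    hX p hp q hq _ ⟨c', _, hc', h0, h1, rfl⟩
      ⟨_, ⟨mul_nonneg ht.1 hc'.1, mul_le_of_le_one_left hc'.1 ht.2⟩, rfl⟩
  have key := hconv c c' l _ hc hc' t ht
  rw [h0, h1] at key
  have := infDist_le_dist_of_mem (x := c (t * l)) hmem
  nlinarith [mul_le_mul_of_nonneg_left hcp.le (sub_nonneg.2 ht.2),
    mul_le_mul_of_nonneg_left hcq.le ht.1]

theorem GeodesicConvexFun.add_mul {f g : E → ℝ} (hf : GeodesicConvexFun f)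
    (hg : GeodesicConvexFun g) {α : ℝ} (hα : 0 ≤ α) :
    GeodesicConvexFun fun x => f x + α * g x := by
  intro c l hc t ht
  have h₁ := hf c l hc t ht
  have h₂ := mul_le_mul_of_nonneg_left (hg c l hc t ht) hα
  dsimp only
  linarith

theorem GeodesicConvexFun.geodesicConvex_le {f : E → ℝ} (hf : GeodesicConvexFun f) (r : ℝ) :
    GeodesicConvex {x | f x ≤ r} := by
  rintro x hx y hy _ ⟨c, l, hc, rfl, rfl, rfl⟩ _ ⟨s, hs, rfl⟩
  rcases hc.1.eq_or_lt with hl | hl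
  · obtain rfl : s = 0 := le_antisymm (hl ▸ hs.2) hs.1
    exact hx
  · have ht : s / l ∈ Icc (0 : ℝ) 1 := ⟨div_nonneg hs.1 hl.le, (div_le_one hl).2 hs.2⟩
    have key := hf c l hc (s / l) ht
    rw [div_mul_cancel₀ _ hl.ne'] at key
    simp only [mem_ofPred_eq] at hx hy ⊢
    nlinarith [mul_le_mul_of_nonneg_left hx (sub_nonneg.2 ht.2),
      mul_le_mul_of_nonneg_left hy ht.1]

theorem GeodesicConvex.inter {X Y : Set E} (hX : GeodesicConvex X) (hY : GeodesicConvex Y) :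
    GeodesicConvex (X ∩ Y) := fun x hx y hy S hS =>
  subset_inter (hX x hx.1 y hy.1 S hS) (hY x hx.2 y hy.2 S hS)

end Convexity

section Attainment

variable {E : Type*} [MetricSpace E]

/-- In a reflexive space with convex metric, bounded closed convex sets are proximinal. -/
theorem ReflexiveGeodesicSpace.exists_dist_le_infDist (hrefl : ReflexiveGeodesicSpace E)
    (hconv : HasConvexMetric E) (X : Pbclcv E) (a : E) :
    ∃ x ∈ X.1, dist a x ≤ infDist a X.1 := by
  obtain ⟨hne, hbd, hcl, hcv⟩ := X.2
  obtain ⟨x, hx⟩ := hrefl (fun n : ℕ => X.1 ∩ {x | dist x a ≤ infDist a X.1 + 1 / ((n : ℝ) + 1)})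
    (fun n => by
      obtain ⟨x, hx, hlt⟩ := (infDist_lt_iff hne).1
        (lt_add_of_pos_right (infDist a X.1) (Nat.one_div_pos_of_nat (α := ℝ) (n := n)))
      exact ⟨x, hx, by rw [mem_ofPred_eq, dist_comm]; exact hlt.le⟩)
    (fun n => hbd.subset inter_subset_left)
    (fun n => hcl.inter (isClosed_le (continuous_id.dist continuous_const) continuous_const))
    (fun n => hcv.inter ((geodesicConvexFun_dist hconv a).geodesicConvex_le _))
    (fun n => inter_subset_inter_right _ fun x (hx : dist x a ≤ _) =>
      hx.trans (add_le_add_right (Nat.one_div_le_one_div n.le_succ) _))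
  rw [mem_iInter] at hx
  refine ⟨x, (hx 0).1, ?_⟩
  have hlim : Tendsto (fun n : ℕ => infDist a X.1 + 1 / ((n : ℝ) + 1)) atTop
      (nhds (infDist a X.1 + 0)) := tendsto_const_nhds.add tendsto_one_div_add_atTop_nhds_zero_nat
  rw [add_zero] at hlim
  rw [dist_comm]
  exact ge_of_tendsto' hlim fun n => (hx n).2

theorem ReflexiveGeodesicSpace.exists_dist_eq_infSetDist (hrefl : ReflexiveGeodesicSpace E)
    (hconv : HasConvexMetric E) {A : Set E} (hA : A.Nonempty) (hAcp : IsCompact A)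
    (X : Pbclcv E) : ∃ a ∈ A, ∃ x ∈ X.1, dist a x = infSetDist A X.1 := by
  obtain ⟨a, ha, hmin⟩ := hAcp.exists_isMinOn hA (continuous_infDist_pt X.1).continuousOn
  obtain ⟨x, hx, hax⟩ := hrefl.exists_dist_le_infDist hconv X a
  refine ⟨a, ha, x, hx, le_antisymm ?_ (infSetDist_le_dist ha hx)⟩
  exact le_infSetDist hA X.2.1 fun b hb y hy =>
    (hax.trans (hmin hb)).trans (infDist_le_dist_of_mem hy)

end Attainment

section GDelta

variable {E : Type*} [MetricSpace E]

/-- The sets `X` for which the almost minimizers of `min(A,X)` lie within `ε` of each other. -/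
def minOscLe (A : Set E) (ε : ℝ) : Set (Pbclcv E) :=
  {X | ∃ σ > 0, ∀ a ∈ A, ∀ a' ∈ A, ∀ x ∈ X.1, ∀ x' ∈ X.1,
    dist a x < infSetDist A X.1 + σ → dist a' x' < infSetDist A X.1 + σ →
      dist a a' ≤ ε ∧ dist x x' ≤ ε}

theorem minOscLe_subset_interior {A : Set E} (hA : A.Nonempty) {ε : ℝ} (hε : 0 < ε) :
    minOscLe A ε ⊆ interior (minOscLe A (2 * ε)) := by
  rintro X ⟨σ, hσ, hX⟩
  rw [mem_interior_iff_mem_nhds, Metric.mem_nhds_iff]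
  set δ := min (ε / 2) (σ / 4)
  have hδ : 0 < δ := lt_min (by positivity) (by positivity)
  have hδε : δ ≤ ε / 2 := min_le_left _ _
  have hδσ : δ ≤ σ / 4 := min_le_right _ _
  refine ⟨δ, hδ, fun Y hY => ⟨σ / 4, by positivity, fun a ha a' ha' y hy y' hy' hay hay' => ?_⟩⟩
  rw [Metric.mem_ball] at hY
  have hYX : hausdorffDist Y.1 X.1 < δ := hY
  have htop : hausdorffEDist Y.1 X.1 ≠ ⊤ :=
    hausdorffEDist_ne_top_of_nonempty_of_bounded Y.2.1 X.2.1 Y.2.2.1 X.2.2.1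
  have hle : infSetDist A Y.1 ≤ infSetDist A X.1 + hausdorffDist X.1 Y.1 :=
    infSetDist_le_infSetDist_add_hausdorffDist hA X.2.1 (by rwa [hausdorffEDist_comm])
  rw [hausdorffDist_comm] at hle
  obtain ⟨x, hx, hyx⟩ := exists_dist_lt_of_hausdorffDist_lt hy hYX htop
  obtain ⟨x', hx', hyx'⟩ := exists_dist_lt_of_hausdorffDist_lt hy' hYX htop
  obtain ⟨h₁, h₂⟩ := hX a ha a' ha' x hx x' hx' (by linarith [dist_triangle a y x])
    (by linarith [dist_triangle a' y' x'])
  refine ⟨by linarith, ?_⟩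
  have := dist_triangle4 y x x' y'
  rw [dist_comm x' y'] at this
  linarith

theorem MinWellPosed.mem_minOscLe {A : Set E} {X : Pbclcv E} (h : MinWellPosed A X.1)
    {ε : ℝ} (hε : 0 < ε) : X ∈ minOscLe A ε := by
  obtain ⟨a₀, _, x₀, _, _, _, hseq⟩ := h
  by_contra hX
  simp only [minOscLe, mem_ofPred_eq, not_exists, not_and] at hX
  have hX' : ∀ n : ℕ, ∃ a ∈ A, ∃ a' ∈ A, ∃ x ∈ X.1, ∃ x' ∈ X.1,
      dist a x < infSetDist A X.1 + 1 / ((n : ℝ) + 1) ∧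
      dist a' x' < infSetDist A X.1 + 1 / ((n : ℝ) + 1) ∧
      ¬ (dist a a' ≤ ε ∧ dist x x' ≤ ε) := by
    intro n
    have := hX _ (Nat.one_div_pos_of_nat (α := ℝ) (n := n))
    push Not at this
    obtain ⟨a, ha, a', ha', x, hx, x', hx', h₁, h₂, h₃⟩ := this
    exact ⟨a, ha, a', ha', x, hx, x', hx', h₁, h₂, fun h => (h₃ h.1).not_ge h.2⟩
  choose a ha a' ha' x hx x' hx' h₁ h₂ h₃ using hX'
  have hlim : Tendsto (fun n : ℕ => infSetDist A X.1 + 1 / ((n : ℝ) + 1)) atTop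
      (nhds (infSetDist A X.1)) := by
    simpa using tendsto_const_nhds.add (tendsto_one_div_add_atTop_nhds_zero_nat (𝕜 := ℝ))
  obtain ⟨ta, tx⟩ := hseq a x ha hx (tendsto_of_tendsto_of_tendsto_of_le_of_le
    tendsto_const_nhds hlim (fun n => infSetDist_le_dist (ha n) (hx n)) fun n => (h₁ n).le)
  obtain ⟨ta', tx'⟩ := hseq a' x' ha' hx' (tendsto_of_tendsto_of_tendsto_of_le_of_le
    tendsto_const_nhds hlim (fun n => infSetDist_le_dist (ha' n) (hx' n)) fun n => (h₂ n).le)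
  have da := ta.dist ta'
  have dx := tx.dist tx'
  rw [dist_self] at da dx
  obtain ⟨n, hna, hnx⟩ := ((da.eventually_lt_const hε).and (dx.eventually_lt_const hε)).exists
  exact h₃ n ⟨hna.le, hnx.le⟩

theorem minWellPosed_of_forall_mem_minOscLe (hrefl : ReflexiveGeodesicSpace E)
    (hconv : HasConvexMetric E) {A : Set E} (hA : A.Nonempty) (hAcp : IsCompact A)
    {X : Pbclcv E} (h : ∀ ε > 0, X ∈ minOscLe A ε) : MinWellPosed A X.1 := by
  obtain ⟨a₀, ha₀, x₀, hx₀, h₀⟩ := hrefl.exists_dist_eq_infSetDist hconv hA hAcp X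
  refine ⟨a₀, ha₀, x₀, hx₀, h₀, fun a ha x hx hax => ?_, fun a x ha hx hax => ?_⟩
  · have key : ∀ ε > 0, dist a a₀ ≤ ε ∧ dist x x₀ ≤ ε := fun ε hε => by
      obtain ⟨σ, hσ, hX⟩ := h ε hε
      exact hX a ha a₀ ha₀ x hx x₀ hx₀ (by linarith) (by linarith)
    exact ⟨eq_of_forall_dist_le fun ε hε => (key ε hε).1,
      eq_of_forall_dist_le fun ε hε => (key ε hε).2⟩
  · have key : ∀ ε > 0, ∀ᶠ n in atTop, dist (a n) a₀ < ε ∧ dist (x n) x₀ < ε := fun ε hε => by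
      obtain ⟨σ, hσ, hX⟩ := h (ε / 2) (half_pos hε)
      filter_upwards [hax.eventually_lt_const (lt_add_of_pos_right _ hσ)] with n hn
      obtain ⟨h₁, h₂⟩ := hX (a n) (ha n) a₀ ha₀ (x n) (hx n) x₀ hx₀ hn (by linarith)
      exact ⟨by linarith, by linarith⟩
    exact ⟨Metric.tendsto_nhds.2 fun ε hε => (key ε hε).mono fun _ hn => hn.1,
      Metric.tendsto_nhds.2 fun ε hε => (key ε hε).mono fun _ hn => hn.2⟩

theorem isGδ_setOf_minWellPosed (hrefl : ReflexiveGeodesicSpace E)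
    (hconv : HasConvexMetric E) {A : Set E} (hA : A.Nonempty) (hAcp : IsCompact A) :
    IsGδ {X : Pbclcv E | MinWellPosed A X.1} := by
  have : {X : Pbclcv E | MinWellPosed A X.1} =
      ⋂ n : ℕ, interior (minOscLe A (2 * (1 / ((n : ℝ) + 1)))) := by
    ext X
    rw [mem_iInter]
    refine ⟨fun h n => minOscLe_subset_interior hA Nat.one_div_pos_of_nat
      (h.mem_minOscLe Nat.one_div_pos_of_nat), fun h => ?_⟩
    refine minWellPosed_of_forall_mem_minOscLe hrefl hconv hA hAcp fun ε hε => ?_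
    obtain ⟨n, hn⟩ := exists_nat_one_div_lt (half_pos hε)
    obtain ⟨σ, hσ, hX⟩ := interior_subset (h n)
    refine ⟨σ, hσ, fun a ha a' ha' x hx x' hx' h₁ h₂ => ?_⟩
    obtain ⟨h₃, h₄⟩ := hX a ha a' ha' x hx x' hx' h₁ h₂
    exact ⟨by linarith, by linarith⟩
  rw [this]
  exact IsGδ.iInter_of_isOpen fun _ => isOpen_interior

end GDelta

section Density

variable {E : Type*} [MetricSpace E]

/-- Two geodesic paths can be concatenated when the lengths add up to the distance of the
extreme endpoints. -/
theorem IsGeodesicPath.concat {c c' : ℝ → E} {l l' : ℝ} (hc : IsGeodesicPath c l)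
    (hc' : IsGeodesicPath c' l') (h : c l = c' 0) (hd : dist (c 0) (c' l') = l + l') :
    IsGeodesicPath (fun t => if t ≤ l then c t else c' (t - l)) (l + l') := by
  have key : ∀ s ∈ Icc (0 : ℝ) (l + l'), ∀ t ∈ Icc (0 : ℝ) (l + l'), s ≤ t →
      dist (if s ≤ l then c s else c' (s - l)) (if t ≤ l then c t else c' (t - l)) = t - s := by
    intro s hs t ht hst
    split_ifs with h₁ h₂ h₂
    · rw [hc.2 s ⟨hs.1, h₁⟩ t ⟨ht.1, h₂⟩, abs_sub_comm, abs_of_nonneg (by linarith)]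
    · rw [not_le] at h₂
      have ht' : t - l ∈ Icc (0 : ℝ) l' := ⟨by linarith, by linarith [ht.2]⟩
      have e₁ := hc.2 s ⟨hs.1, h₁⟩ l (right_mem_Icc.2 hc.1)
      have e₂ := hc'.2 0 (left_mem_Icc.2 hc'.1) (t - l) ht'
      have e₃ := hc.2 0 (left_mem_Icc.2 hc.1) s ⟨hs.1, h₁⟩
      have e₄ := hc'.2 (t - l) ht' l' (right_mem_Icc.2 hc'.1)
      rw [abs_of_nonpos (by linarith)] at e₁ e₂
      rw [abs_of_nonpos (by linarith [ht'.2])] at e₄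
      rw [abs_of_nonpos (by linarith [hs.1])] at e₃
      rw [h] at e₁
      refine le_antisymm ?_ ?_
      · linarith [dist_triangle (c s) (c' 0) (c' (t - l))]
      · linarith [dist_triangle4 (c 0) (c s) (c' (t - l)) (c' l')]
    · linarith
    · rw [hc'.2 (s - l) ⟨by linarith, by linarith [hs.2]⟩ (t - l) ⟨by linarith, by linarith [ht.2]⟩,
        abs_sub_comm, abs_of_nonneg (by linarith)]
      ring
  refine ⟨add_nonneg hc.1 hc'.1, fun s hs t ht => ?_⟩
  rcases le_total s t with hst | hst
  · rw [abs_sub_comm, abs_of_nonneg (sub_nonneg.2 hst)]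
    exact key s hs t ht hst
  · rw [abs_of_nonneg (sub_nonneg.2 hst), dist_comm]
    exact key t ht s hs hst

/-- Without bifurcating geodesics, a geodesic has at most one endpoint at a given distance past
an interior point. -/
theorem NoBifurcatingGeodesics.eq_of_dist_eq (hgeo : IsGeodesicSpace E)
    (hbif : NoBifurcatingGeodesics E) {c : ℝ → E} {l r : ℝ} (hc : IsGeodesicPath c l)
    (hr : 0 < r) (hrl : r < l) {b : E} (hb : dist (c r) b = l - r) (hb' : dist (c 0) b = l) :
    b = c l := by
  have hcr : IsGeodesicPath c r :=
    ⟨hr.le, fun s hs t ht => hc.2 s ⟨hs.1, hs.2.trans hrl.le⟩ t ⟨ht.1, ht.2.trans hrl.le⟩⟩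
  obtain ⟨c', hc', h0, h1⟩ := hgeo.exists_path (c r) b
  have hcc := hcr.concat hc' h0.symm (by rw [h1, hb, hb']; ring)
  set g : ℝ → E := fun t => if t ≤ r then c t else c' (t - r) with hg
  rw [hb, add_sub_cancel] at hcc
  have g0 : g 0 = c 0 := if_pos hr.le
  have gr : g r = c r := if_pos le_rfl
  have gl : g l = b := by
    rw [hg]
    simp only [if_neg hrl.not_ge]
    rw [← hb, h1]
  have hl : 0 ≤ l := hc.1
  have endpoint : ∀ {f k : ℝ → E}, IsGeodesicPath f l → IsGeodesicPath k l → f 0 = k 0 →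
      f '' Icc 0 l ⊆ k '' Icc 0 l → f l = k l := by
    intro f k hf hk h0 hsub
    obtain ⟨s, hs, hsl⟩ := hsub ⟨l, right_mem_Icc.2 hl, rfl⟩
    have e := hk.2 0 (left_mem_Icc.2 hl) s hs
    rw [hsl, ← h0, hf.dist_endpoints, zero_sub, abs_neg, abs_of_nonneg hs.1] at e
    rw [e, hsl, ← e]
  have hrmem : r ∈ Icc 0 l := ⟨hr.le, hrl.le⟩
  have hne : c r ≠ c 0 := by
    rw [← dist_pos, hc.2 r hrmem 0 (left_mem_Icc.2 hl), sub_zero, abs_of_pos hr]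
    exact hr
  rcases hbif (c 0) (c l) b (c '' Icc 0 l) (g '' Icc 0 l) ⟨c, l, hc, rfl, rfl, rfl⟩
    ⟨g, l, hcc, g0, gl, rfl⟩ (c r) ⟨r, hrmem, rfl⟩ ⟨r, hrmem, gr⟩ hne with h | h | h
  · exact h.2.symm.trans h.1
  · rw [← gl]
    exact (endpoint hc hcc g0.symm h).symm
  · rw [← gl]
    exact endpoint hcc hc g0 h

/-- Adding a drop-like neighbourhood, with vertex slightly moved towards `A` from a nearest
point, makes the minimization problem well-posed. -/
theorem exists_dist_le_minWellPosed (hgeo : IsGeodesicSpace E) (hconv : HasConvexMetric E)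
    (hrefl : ReflexiveGeodesicSpace E) (hbif : NoBifurcatingGeodesics E)
    {A : Set E} (hA : A.Nonempty) (hAcp : IsCompact A) (X : Pbclcv E)
    (hX : 0 < infSetDist A X.1) {ε : ℝ} (hε : 0 < ε) (hεX : ε < infSetDist A X.1) :
    ∃ Y : Pbclcv E, dist X Y ≤ ε ∧ 0 < infSetDist A Y.1 ∧ MinWellPosed A Y.1 := by
  obtain ⟨a₀, ha₀, x₀, hx₀, h₀⟩ := hrefl.exists_dist_eq_infSetDist hconv hA hAcp X
  set r := infSetDist A X.1
  obtain ⟨c, hc, hc0, hcr⟩ := hgeo.exists_path x₀ a₀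
  rw [dist_comm, h₀] at hc hcr
  set z := c ε
  have hεmem : ε ∈ Icc 0 r := ⟨hε.le, hεX.le⟩
  have hx₀z : dist x₀ z = ε := by
    rw [← hc0, hc.2 0 (left_mem_Icc.2 hX.le) ε hεmem, zero_sub, abs_neg, abs_of_pos hε]
  have hza₀ : dist a₀ z = r - ε := by
    rw [← hcr, hc.2 r (right_mem_Icc.2 hX.le) ε hεmem, abs_of_pos (sub_pos.2 hεX)]
  obtain ⟨D, hD⟩ := X.2.2.1.subset_closedBall z
  have hD0 : 0 < D := hε.trans_le (hx₀z ▸ hD hx₀)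
  set α := ε / D
  have hα : 0 < α := div_pos hε hD0
  have hαD : α * D = ε := div_mul_cancel₀ _ hD0.ne'
  set S : Set E := {y | infDist y X.1 + α * dist y z ≤ ε}
  have hXS : X.1 ⊆ S := fun x hx => by
    have := mul_le_mul_of_nonneg_left (mem_closedBall.1 (hD hx)) hα.le
    simp only [S, mem_ofPred_eq, infDist_zero_of_mem hx]
    linarith
  have hzS : z ∈ S := by
    have := infDist_le_dist_of_mem (x := z) hx₀
    rw [dist_comm, hx₀z] at this
    simpa [S] using this
  have hSbd : IsBounded S := isBounded_closedBall.subset (t := closedBall z D) fun y hy => by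
    have hy' : infDist y X.1 + α * dist y z ≤ ε := hy
    have : α * dist y z ≤ α * D := by linarith [infDist_nonneg (x := y) (s := X.1)]
    exact mem_closedBall.2 (le_of_mul_le_mul_left this hα)
  have hScl : IsClosed S :=
    isClosed_le ((continuous_infDist_pt _).add
      (continuous_const.mul (continuous_id.dist continuous_const))) continuous_const
  have hScv : GeodesicConvex S :=
    ((geodesicConvexFun_infDist hgeo hconv X.2.1 X.2.2.2.2).add_mul
      (geodesicConvexFun_dist hconv z) hα.le).geodesicConvex_le ε
  have hlow : ∀ a ∈ A, ∀ y ∈ S, r - ε + α * dist y z ≤ dist a y := fun a ha y hy => by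
    have h₁ : r ≤ infDist a X.1 :=
      (le_infDist X.2.1).2 fun x hx => infSetDist_le_dist ha hx
    have h₂ : infDist a X.1 ≤ infDist y X.1 + dist a y := infDist_le_infDist_add_dist
    have h₃ : infDist y X.1 + α * dist y z ≤ ε := hy
    linarith
  have hinf : infSetDist A S = r - ε := by
    refine le_antisymm (hza₀ ▸ infSetDist_le_dist ha₀ hzS) ?_
    refine le_infSetDist hA ⟨z, hzS⟩ fun a ha y hy => ?_
    have := hlow a ha y hy
    have : 0 ≤ α * dist y z := by positivity
    linarith
  have huniq : ∀ a ∈ A, dist a z = r - ε → a = a₀ := fun a ha haz => by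
    have h₁ : r ≤ dist a x₀ := infSetDist_le_dist ha hx₀
    rw [← hcr]
    refine hbif.eq_of_dist_eq hgeo hc hε hεX (by rwa [dist_comm]) (le_antisymm ?_ ?_)
    · rw [hc0]
      linarith [dist_triangle x₀ z a, dist_comm z a]
    · rwa [hc0, dist_comm]
  refine ⟨⟨S, ⟨z, hzS⟩, hSbd, hScl, hScv⟩, ?_, ?_, a₀, ha₀, z, hzS, ?_, ?_, ?_⟩
  · refine hausdorffDist_le_of_infDist hε.le (fun x hx => ?_) fun y hy => ?_
    · rw [infDist_zero_of_mem (hXS hx)]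
      exact hε.le
    · have h₃ : infDist y X.1 + α * dist y z ≤ ε := hy
      have : 0 ≤ α * dist y z := by positivity
      linarith
  · exact hinf ▸ sub_pos.2 hεX
  · rw [hinf, hza₀]
  · intro a ha y hy hay
    rw [hinf] at hay
    have h₁ := hlow a ha y hy
    have hyz : y = z := by
      rw [← dist_le_zero]
      exact nonpos_of_mul_nonpos_right (by linarith) hα
    exact ⟨huniq a ha (hyz ▸ hay), hyz⟩
  · intro a y ha hy hay
    rw [hinf] at hay
    have hy_lim : Tendsto y atTop (nhds z) := by
      rw [tendsto_iff_dist_tendsto_zero]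
      have hlim : Tendsto (fun n => α⁻¹ * (dist (a n) (y n) - (r - ε))) atTop (nhds 0) := by
        simpa using (hay.sub_const (r - ε)).const_mul α⁻¹
      refine squeeze_zero (fun _ => dist_nonneg) (fun n => ?_) hlim
      rw [inv_mul_eq_div, le_div_iff₀ hα]
      linarith [hlow (a n) (ha n) (y n) (hy n)]
    refine ⟨?_, hy_lim⟩
    refine tendsto_of_subseq_tendsto fun ns hns => ?_
    obtain ⟨b, hb, φ, hφ, hlim⟩ := hAcp.tendsto_subseq fun n => ha (ns n)
    have hsub : Tendsto (fun n => ns (φ n)) atTop atTop := hns.comp hφ.tendsto_atTop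
    have hbz : dist b z = r - ε :=
      tendsto_nhds_unique (hlim.dist (hy_lim.comp hsub)) (hay.comp hsub)
    exact ⟨φ, huniq b hb hbz ▸ hlim⟩

end Density

/-- in a reflexive geodesic space with convex metric and no bifurcating
geodesics, for `A` compact, the sets for which `min(A,X)` is well-posed form a dense
`G_δ`-set in `P^A_{b,cl,cv}(E)`. -/
theorem statement9 {E : Type*} [MetricSpace E] (hgeo : IsGeodesicSpace E)
    (hconv : HasConvexMetric E) (hrefl : ReflexiveGeodesicSpace E)
    (hbif : NoBifurcatingGeodesics E)
    (A : Set E) (hA : A.Nonempty) (hAcp : IsCompact A) :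
    Dense {X : ↥(PAbclcv A) | MinWellPosed A X.1.1} ∧
    IsGδ {X : ↥(PAbclcv A) | MinWellPosed A X.1.1} := by
  refine ⟨fun X => Metric.mem_closure_iff.2 fun ε hε => ?_,
    IsGδ.preimage (f := Subtype.val) continuous_subtype_val
      (isGδ_setOf_minWellPosed hrefl hconv hA hAcp)⟩
  obtain ⟨X', hX', hXX'⟩ := Metric.mem_closure_iff.1 X.2 (ε / 2) (half_pos hε)
  rw [mem_ofPred_eq, infSetDist_comm] at hX'
  obtain ⟨δ, hδ, hδlt⟩ := exists_between (lt_min (half_pos hε) hX')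
  obtain ⟨Y, hY, hYA, hYwp⟩ := exists_dist_le_minWellPosed hgeo hconv hrefl hbif hA hAcp X' hX' hδ
    (hδlt.trans_le (min_le_right _ _))
  refine ⟨⟨Y, subset_closure ?_⟩, hYwp, ?_⟩
  · rwa [mem_ofPred_eq, infSetDist_comm]
  · have := hδlt.trans_le (min_le_left _ _)
    have := dist_triangle X.1 X' Y
    rw [Subtype.dist_eq]
    linarith
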